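/- Discrete Noether conservation law. With the discrete variational setup below, let K ⊆ F be a finite set of facets, let y : Π v : V, E v be a discrete field, and let D : Π v : V, (E v → E v) be a family of vertical vector fields. Assume: (1) each L_β (β ∈ F) is everywhere Fréchet-differentiable and D is an infinitesimal symmetry of the discrete Lagrangian density, i.e., for every β ∈ F and every z : Π k : Fin (n+1), E (β k) one has Σ_{k : Fin (n+1)} ∂ᵏL_β(z) (D (β k) (z k)) = 0; (2) y is critical, i.e., for every vertex v interior to K the discrete Euler–Lagrange equation Σ_{β ∈ Star v} ∂^{(v,β)}L_β(jyβ) = 0 holds. Then the total Noether current over the frontier vanishes: Σ over the vertices v ∈ Cl K that are not interior to K of μ_K(y)(v)(D v (y v)) equals 0. -/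

import Mathlib

open scoped Classical

/-- The continuous linear inclusion of `E (β k)` as the `k`-th coordinate of `Π k, E (β k)`. -/
noncomputable def coordIncl {V : Type*} {n : ℕ} (E : V → Type*)
    [∀ v, NormedAddCommGroup (E v)] [∀ v, NormedSpace ℝ (E v)]
    (β : Fin (n + 1) → V) (k : Fin (n + 1)) :
    E (β k) →L[ℝ] (∀ j, E (β j)) :=
  ContinuousLinearMap.pi (Pi.single k (ContinuousLinearMap.id ℝ (E (β k))))

/-- The partial derivative `∂^{(v,β)} L (z) : E v →L[ℝ] ℝ` of a discrete Lagrangian `L` on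
the facet `β` at the vertex `v`: the Fréchet derivative of `L` at `z` composed with the
inclusion of the coordinate corresponding to `v` (and `0` if `v` is not a vertex of `β`). -/
noncomputable def dpart {V : Type*} {n : ℕ} (E : V → Type*)
    [∀ v, NormedAddCommGroup (E v)] [∀ v, NormedSpace ℝ (E v)]
    (β : Fin (n + 1) → V) (L : (∀ k, E (β k)) → ℝ) (z : ∀ k, E (β k)) (v : V) :
    E v →L[ℝ] ℝ :=
  if h : v ∈ Set.range β then
    h.choose_spec ▸ ((fderiv ℝ L z).comp (coordIncl E β h.choose))
  else 0

/-- The discrete Noether current `μ_K(y)(v) = ∑_{β ∈ K ∩ Star v} ∂^{(v,β)} L_β (jyβ)`. -/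
noncomputable def noetherCurrent {V : Type*} {n : ℕ} (E : V → Type*)
    [∀ v, NormedAddCommGroup (E v)] [∀ v, NormedSpace ℝ (E v)]
    (F : Set (Fin (n + 1) → V))
    (L : ∀ β : Fin (n + 1) → V, (∀ k, E (β k)) → ℝ)
    (K : Set (Fin (n + 1) → V)) (y : ∀ v, E v) (v : V) :
    E v →L[ℝ] ℝ :=
  ∑ᶠ β ∈ K ∩ {β ∈ F | v ∈ Set.range β}, dpart E β (L β) (fun k => y (β k)) v

theorem coordIncl_apply {V : Type*} {n : ℕ} (E : V → Type*)
    [∀ v, NormedAddCommGroup (E v)] [∀ v, NormedSpace ℝ (E v)]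
    (β : Fin (n + 1) → V) (k : Fin (n + 1)) (w : E (β k)) :
    coordIncl E β k w = Pi.single k w := by
  ext j
  by_cases hj : j = k
  · subst hj
    simp [coordIncl]
  · simp [coordIncl, Pi.single_eq_of_ne hj]

theorem dpart_apply {V : Type*} {n : ℕ} (E : V → Type*)
    [∀ v, NormedAddCommGroup (E v)] [∀ v, NormedSpace ℝ (E v)]
    {β : Fin (n + 1) → V} (hβ : Function.Injective β) (L : (∀ k, E (β k)) → ℝ)
    (z : ∀ k, E (β k)) (k : Fin (n + 1)) (w : E (β k)) :
    dpart E β L z (β k) w = fderiv ℝ L z (Pi.single k w) := by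
  have transport : ∀ (i : Fin (n + 1)) (h : β i = β k),
      (h ▸ ((fderiv ℝ L z).comp (coordIncl E β i)) : E (β k) →L[ℝ] ℝ) w =
        fderiv ℝ L z (Pi.single k w) := by
    intro i h
    obtain rfl : i = k := hβ h
    simp [coordIncl_apply]
  rw [dpart, dif_pos (Set.mem_range_self k)]
  exact transport _ _

theorem dpart_of_notMem_range {V : Type*} {n : ℕ} (E : V → Type*)
    [∀ v, NormedAddCommGroup (E v)] [∀ v, NormedSpace ℝ (E v)]
    {β : Fin (n + 1) → V} (L : (∀ k, E (β k)) → ℝ) (z : ∀ k, E (β k)) {v : V}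
    (hv : v ∉ Set.range β) : dpart E β L z v = 0 :=
  dif_neg hv

/-- Outside the star of `v` the partial derivatives at `v` vanish, so the Noether current
is a sum over all of `K`. -/
theorem noetherCurrent_eq_sum {V : Type*} {n : ℕ} (E : V → Type*)
    [∀ v, NormedAddCommGroup (E v)] [∀ v, NormedSpace ℝ (E v)]
    {F : Set (Fin (n + 1) → V)} (L : ∀ β : Fin (n + 1) → V, (∀ k, E (β k)) → ℝ)
    {K : Set (Fin (n + 1) → V)} (hKF : K ⊆ F) (hK : K.Finite) (y : ∀ v, E v) (v : V) :
    noetherCurrent E F L K y v =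
      ∑ β ∈ hK.toFinset, dpart E β (L β) (fun k => y (β k)) v := by
  rw [noetherCurrent, ← finsum_mem_eq_finite_toFinset_sum _ hK]
  refine finsum_mem_inter_support_eq' _ _ _ fun β hβ => ?_
  have hv : v ∈ Set.range β := by
    by_contra hv
    exact hβ (dpart_of_notMem_range E _ _ hv)
  exact ⟨fun h => h.1, fun h => ⟨h, hKF h, hv⟩⟩

/-- The sum over the vertices of a facet of the partial derivatives, paired with the values of
the vertical field, is the derivative of the Lagrangian along that field. -/
theorem sum_dpart_apply {V : Type*} {n : ℕ} (E : V → Type*)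
    [∀ v, NormedAddCommGroup (E v)] [∀ v, NormedSpace ℝ (E v)]
    {β : Fin (n + 1) → V} (hβ : Function.Injective β) (L : (∀ k, E (β k)) → ℝ)
    (z : ∀ k, E (β k)) (X : ∀ v, E v) {C : Finset V} (hC : ∀ k, β k ∈ C) :
    ∑ v ∈ C, dpart E β L z v (X v) =
      ∑ k : Fin (n + 1), fderiv ℝ L z (Pi.single k (X (β k))) := by
  have hsub : Finset.univ.image β ⊆ C := by
    simpa [Finset.image_subset_iff] using hC
  rw [← Finset.sum_subset hsub, Finset.sum_image hβ.injOn]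
  · exact Finset.sum_congr rfl fun k _ => dpart_apply E hβ L z k _
  · intro v _ hv
    rw [dpart_of_notMem_range E L z (by simpa using hv)]
    rfl

/-- Discrete Noether conservation law: for a discrete field satisfying the discrete
Euler–Lagrange equations at all interior vertices of a finite domain `K`, and for a
vertical infinitesimal symmetry `D` of the discrete Lagrangian density, the total
Noether current over the frontier vertices of `K` vanishes. -/
theorem discrete_noether_conservation {V : Type*} {n : ℕ}
    (F : Set (Fin (n + 1) → V)) (hF : ∀ β ∈ F, Function.Injective β)
    (E : V → Type*) [∀ v, NormedAddCommGroup (E v)] [∀ v, NormedSpace ℝ (E v)]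
    (L : ∀ β : Fin (n + 1) → V, (∀ k, E (β k)) → ℝ)
    (K : Set (Fin (n + 1) → V)) (hKF : K ⊆ F) (hK : K.Finite)
    (y : ∀ v, E v) (D : ∀ v : V, E v → E v)
    (hdiff : ∀ β ∈ F, Differentiable ℝ (L β))
    (hsym : ∀ β ∈ F, ∀ z : ∀ k, E (β k),
      ∑ k : Fin (n + 1), fderiv ℝ (L β) z (Pi.single k (D (β k) (z k))) = 0)
    (hcrit : ∀ v : V, {β ∈ F | v ∈ Set.range β} ⊆ K →
      ∑ᶠ β ∈ {β ∈ F | v ∈ Set.range β}, dpart E β (L β) (fun k => y (β k)) v = 0) :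
    ∑ᶠ v ∈ {v : V | (∃ β ∈ K, v ∈ Set.range β) ∧ ¬ ({β ∈ F | v ∈ Set.range β} ⊆ K)},
      (noetherCurrent E F L K y v) (D v (y v)) = 0 := by
  let C : Finset V := hK.toFinset.biUnion fun β => Finset.univ.image β
  have hC : ∀ v, v ∈ C ↔ ∃ β ∈ K, v ∈ Set.range β := by
    intro v
    simp [C]
  have interior_current : ∀ v, {β ∈ F | v ∈ Set.range β} ⊆ K →
      noetherCurrent E F L K y v = 0 := by
    intro v hv
    rw [noetherCurrent, Set.inter_eq_right.mpr hv, hcrit v hv]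
  have frontier_sum :
      ∑ᶠ v ∈ {v : V | (∃ β ∈ K, v ∈ Set.range β) ∧ ¬ ({β ∈ F | v ∈ Set.range β} ⊆ K)},
        (noetherCurrent E F L K y v) (D v (y v)) =
      ∑ v ∈ C, (noetherCurrent E F L K y v) (D v (y v)) := by
    rw [← finsum_mem_coe_finset]
    refine finsum_mem_inter_support_eq' _ _ _ fun v hv => ?_
    rw [Finset.mem_coe, hC]
    refine ⟨fun h => h.1, fun h => ⟨h, fun hint => hv ?_⟩⟩
    simp [interior_current v hint]
  rw [frontier_sum]
  simp only [noetherCurrent_eq_sum E L hKF hK, sum_apply]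
  rw [Finset.sum_comm]
  refine Finset.sum_eq_zero fun β hβ => ?_
  have hβK : β ∈ K := hK.mem_toFinset.mp hβ
  rw [sum_dpart_apply E (hF β (hKF hβK)) (L β) _ (fun v => D v (y v))
    fun k => (hC _).mpr ⟨β, hβK, k, rfl⟩]
  exact hsym β (hKF hβK) fun k => y (β k)
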